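/- Asymptotics of the renormalised Bethe vector: for every N ≥ 2, each j = 1,…,N, each σ ∈ {⇑,0,⇓}^N and all fixed generic nonzero w_k (k ≠ j), lim_{t→∞} t^{−(N−1)} ⟨σ|Ψ̃(w₁,…,w_{j−1}, t, w_{j+1},…,w_N)⟩ = (−1)^{N−j} δ_{σ_j,0} (∏_{k≠j} w_k^{−1}) ⟨σ'|Ψ̃(w₁,…,w_{j−1},w_{j+1},…,w_N)⟩, and lim_{t→0} t^{N−1} ⟨σ|Ψ̃(w₁,…,w_{j−1}, t, w_{j+1},…,w_N)⟩ = (−1)^{j−1} δ_{σ_j,0} (∏_{k≠j} w_k) ⟨σ'|Ψ̃(w₁,…,w_{j−1},w_{j+1},…,w_N)⟩, where σ' ∈ {⇑,0,⇓}^{N−1} is σ with its j-th letter removed, δ_{σ_j,0} = 1 if σ_j = 0 and 0 otherwise, and Ψ̃ on the right-hand side is the renormalised Bethe vector for N−1 sites. -/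

import Mathlib

open Matrix BigOperators Finset

noncomputable section

/-- `[z] = z - z⁻¹`. -/
def br (z : ℂ) : ℂ := z - z⁻¹

/-- R-matrix `R^{(1,2)}(z)` on ℂ²⊗ℂ³; basis `(ε, σ)` with ε ∈ {0=↑,1=↓}, σ ∈ {0=⇑,1=0,2=⇓}. -/
def R12 (q c z : ℂ) : Matrix (Fin 2 × Fin 3) (Fin 2 × Fin 3) ℂ :=
  Matrix.of fun p p' =>
    if p = (0,0) ∧ p' = (0,0) then br (q^2*z)
    else if p = (0,1) ∧ p' = (0,1) then br (q*z)
    else if p = (0,2) ∧ p' = (0,2) then br z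
    else if p = (1,0) ∧ p' = (1,0) then br z
    else if p = (1,1) ∧ p' = (1,1) then br (q*z)
    else if p = (1,2) ∧ p' = (1,2) then br (q^2*z)
    else if p = (0,1) ∧ p' = (1,0) then c
    else if p = (0,2) ∧ p' = (1,1) then c
    else if p = (1,0) ∧ p' = (0,1) then c
    else if p = (1,1) ∧ p' = (0,2) then c
    else 0

/-- `R^{(1,2)}` acting on the auxiliary ℂ² and the j-th site of `(ℂ³)^{⊗N}`. -/
def R12at (q c z : ℂ) {N : ℕ} (j : Fin N) :
    Matrix (Fin 2 × (Fin N → Fin 3)) (Fin 2 × (Fin N → Fin 3)) ℂ :=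
  Matrix.of fun p p' =>
    R12 q c z (p.1, p.2 j) (p'.1, p'.2 j) *
      if ∀ k, k ≠ j → p.2 k = p'.2 k then 1 else 0

/-- Monodromy matrix `𝒯_a(z) = R^{(1,2)}_{a,N}(q⁻¹z/w_N) ⋯ R^{(1,2)}_{a,1}(q⁻¹z/w₁)`. -/
def monodromy (q c : ℂ) {N : ℕ} (w : Fin N → ℂ) (z : ℂ) :
    Matrix (Fin 2 × (Fin N → Fin 3)) (Fin 2 × (Fin N → Fin 3)) ℂ :=
  (((List.finRange N).reverse).map fun j => R12at q c (q⁻¹ * z / w j) j).prod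

/-- The operator 𝒜(z): auxiliary block (↑,↑) of the monodromy matrix. -/
def Aop (q c : ℂ) {N : ℕ} (w : Fin N → ℂ) (z : ℂ) :
    Matrix (Fin N → Fin 3) (Fin N → Fin 3) ℂ :=
  Matrix.of fun σ τ => monodromy q c w z (0, σ) (0, τ)

/-- The operator ℬ(z): auxiliary block (↑,↓) of the monodromy matrix. -/
def Bop (q c : ℂ) {N : ℕ} (w : Fin N → ℂ) (z : ℂ) :
    Matrix (Fin N → Fin 3) (Fin N → Fin 3) ℂ :=
  Matrix.of fun σ τ => monodromy q c w z (0, σ) (1, τ)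

/-- The operator 𝒟(z): auxiliary block (↓,↓) of the monodromy matrix. -/
def Dop (q c : ℂ) {N : ℕ} (w : Fin N → ℂ) (z : ℂ) :
    Matrix (Fin N → Fin 3) (Fin N → Fin 3) ℂ :=
  Matrix.of fun σ τ => monodromy q c w z (1, σ) (1, τ)

/-- Bethe reference state `|∧⟩ = |⇑…⇑⟩`. -/
def vac (N : ℕ) : (Fin N → Fin 3) → ℂ := fun σ => if σ = fun _ => 0 then 1 else 0

/-- Bethe vector `|Ψ(w₁,…,w_N)⟩ = ℬ(w₁)⋯ℬ(w_N)|∧⟩`. -/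
def bethe (q c : ℂ) {N : ℕ} (w : Fin N → ℂ) : (Fin N → Fin 3) → ℂ :=
  (((List.finRange N).map fun j => Bop q c w (w j)).prod).mulVec (vac N)

/-- Renormalised Bethe vector
`|Ψ̃(w₁,…,w_N)⟩ = c^{−N} (∏_{j<k} [q w_j/w_k])⁻¹ |Ψ(w₁,…,w_N)⟩`. -/
def betheTilde (q c : ℂ) {N : ℕ} (w : Fin N → ℂ) : (Fin N → Fin 3) → ℂ :=
  ((c ^ N)⁻¹ *
    (∏ pr ∈ Finset.univ.filter (fun pr : Fin N × Fin N => pr.1 < pr.2),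
      br (q * w pr.1 / w pr.2))⁻¹) • bethe q c w

/-- The product `f (n-1) ⋯ f 1 * f 0`. -/
def revProd {M : Type*} [Monoid M] {n : ℕ} (f : Fin n → M) : M :=
  ((List.finRange n).reverse.map f).prod

/-- The product `f 0 * f 1 ⋯ f (n-1)`. -/
def ordProd {M : Type*} [Monoid M] {n : ℕ} (f : Fin n → M) : M :=
  ((List.finRange n).map f).prod

section Products

variable {M : Type*} [Monoid M] {n : ℕ}

lemma revProd_succ (f : Fin (n + 1) → M) :
    revProd f = revProd (fun i => f i.succ) * f 0 := by
  simp [revProd, List.finRange_succ, Function.comp_def]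

lemma ordProd_succ (f : Fin (n + 1) → M) :
    ordProd f = f 0 * ordProd (fun i => f i.succ) := by
  simp [ordProd, List.finRange_succ, Function.comp_def]

lemma ordProd_smul {A : Type*} [Ring A] [Algebra ℂ A] (c : Fin n → ℂ) (f : Fin n → A) :
    ordProd (fun i => c i • f i) = (∏ i, c i) • ordProd f := by
  induction n with
  | zero => simp [ordProd]
  | succ n ih =>
    rw [ordProd_succ, ordProd_succ, ih, Fin.prod_univ_succ, smul_mul_smul_comm]

lemma revProd_smul {A : Type*} [Ring A] [Algebra ℂ A] (c : Fin n → ℂ) (f : Fin n → A) :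
    revProd (fun i => c i • f i) = (∏ i, c i) • revProd f := by
  induction n with
  | zero => simp [revProd]
  | succ n ih =>
    rw [revProd_succ, revProd_succ, ih, Fin.prod_univ_succ, smul_mul_smul_comm, mul_comm (c 0)]

lemma tendsto_revProd [TopologicalSpace M] [ContinuousMul M] {X : Type*} {l : Filter X}
    {f : X → Fin n → M} {a : Fin n → M}
    (h : ∀ i, Filter.Tendsto (fun x => f x i) l (nhds (a i))) :
    Filter.Tendsto (fun x => revProd (f x)) l (nhds (revProd a)) :=
  tendsto_list_prod _ fun i _ => h i

lemma tendsto_ordProd [TopologicalSpace M] [ContinuousMul M] {X : Type*} {l : Filter X}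
    {f : X → Fin n → M} {a : Fin n → M}
    (h : ∀ i, Filter.Tendsto (fun x => f x i) l (nhds (a i))) :
    Filter.Tendsto (fun x => ordProd (f x)) l (nhds (ordProd a)) :=
  tendsto_list_prod _ fun i _ => h i

end Products

lemma revProd_mul_of_commute {A : Type*} [Ring A] [Algebra ℂ A] {n : ℕ} (f : Fin n → A) (h : A)
    (b : Fin n → ℂ) (hh : ∀ i, f i * h = b i • (h * f i)) :
    revProd f * h = (∏ i, b i) • (h * revProd f) := by
  induction n with
  | zero => simp [revProd]
  | succ n ih =>
    rw [revProd_succ, mul_assoc, hh, mul_smul_comm, ← mul_assoc,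
      ih (fun i => f i.succ) (fun i => b i.succ) (fun i => hh i.succ), Fin.prod_univ_succ,
      smul_mul_assoc, smul_smul, mul_assoc]

/-- A factor `α • (h * g)` in a product can be moved to the two ends when `g` and `h` commute up
to scalars with the factors on the respective sides. -/
lemma revProd_eq_of_commute {A : Type*} [Ring A] [Algebra ℂ A] {n : ℕ} (j : Fin (n + 1))
    (f : Fin (n + 1) → A) (h g : A) (α : ℂ) (a b : Fin n → ℂ) (hj : f j = α • (h * g))
    (hg : ∀ i, g * f (j.succAbove i) = a i • (f (j.succAbove i) * g))
    (hh : ∀ i, f (j.succAbove i) * h = b i • (h * f (j.succAbove i))) :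
    revProd f = (α * ∏ i, if i.castSucc < j then a i else b i) •
      (h * revProd (fun i => f (j.succAbove i)) * g) := by
  induction n with
  | zero =>
    obtain rfl : j = 0 := Fin.eq_zero j
    rw [revProd_succ, hj]
    simp [revProd]
  | succ n ih =>
    induction j using Fin.cases with
    | zero =>
      simp only [Fin.succAbove_zero] at *
      rw [revProd_succ, hj, mul_smul_comm, ← mul_assoc, revProd_mul_of_commute _ h b hh,
        smul_mul_assoc, smul_smul]
      simp
    | succ j =>
      rw [revProd_succ, ih j (fun i => f i.succ) (fun i => a i.succ) (fun i => b i.succ) hj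
        (fun i => by simpa using hg i.succ) (fun i => by simpa using hh i.succ),
        revProd_succ (fun i => f (j.succ.succAbove i)), Fin.prod_univ_succ]
      have h0 := hg 0
      simp only [Fin.succ_succAbove_zero] at h0
      simp only [Fin.succ_succAbove_zero, Fin.succ_succAbove_succ, smul_mul_assoc, mul_assoc, h0,
        mul_smul_comm, smul_smul, Fin.castSucc_zero, Fin.succ_pos, if_true,
        Fin.castSucc_succ, Fin.succ_lt_succ_iff]
      congr 1
      ring

lemma revProd_diagonal {n : ℕ} (x : Fin n → Fin 2 → ℂ) :
    revProd (fun i => diagonal (x i)) = diagonal (fun ε => ∏ i, x i ε) := by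
  induction n with
  | zero => simp [revProd]
  | succ n ih =>
    rw [revProd_succ, ih (fun i => x i.succ), diagonal_mul_diagonal]
    congr 1
    ext ε
    rw [Fin.prod_univ_succ, mul_comm]

lemma revProd_apply_of_diagonal {n : ℕ} (j : Fin (n + 1))
    (f : Fin (n + 1) → Matrix (Fin 2) (Fin 2) ℂ) (x : Fin n → Fin 2 → ℂ)
    (hx : ∀ i, f (j.succAbove i) = diagonal (x i)) (ε ε' : Fin 2) :
    revProd f ε ε' = f j ε ε' * ∏ i, if i.castSucc < j then x i ε' else x i ε := by
  induction n with
  | zero =>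
    obtain rfl : j = 0 := Fin.eq_zero j
    rw [revProd_succ]
    simp [revProd]
  | succ n ih =>
    induction j using Fin.cases with
    | zero =>
      simp only [Fin.succAbove_zero] at hx
      simp only [revProd_succ f, hx, revProd_diagonal, diagonal_mul, Fin.not_lt_zero, if_false]
      rw [mul_comm]
    | succ j =>
      have h0 := hx 0
      simp only [Fin.succ_succAbove_zero] at h0
      rw [revProd_succ, h0, mul_diagonal,
        ih j (fun i => f i.succ) (fun i => x i.succ) (fun i => by simpa using hx i.succ),
        Fin.prod_univ_succ]
      simp only [Fin.castSucc_zero, Fin.succ_pos, if_true,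
        Fin.castSucc_succ, Fin.succ_lt_succ_iff]
      ring

/-- An ordered product of operators intertwined with smaller operators by `e₀` and `e₁`, the
`m`-th operator mapping the range of `e₀` to that of `e₁`. -/
lemma ordProd_mulVec_of_intertwine {ι κ : Type*} [Fintype ι] [DecidableEq ι] [Fintype κ]
    [DecidableEq κ] {n : ℕ} (m : Fin (n + 1)) (f : Fin (n + 1) → Matrix ι ι ℂ)
    (b : Fin n → Matrix κ κ ℂ) (e₀ e₁ : (κ → ℂ) → ι → ℂ) (μ : ℂ) (ν : Fin n → ℂ)
    (hm : ∀ v, f m *ᵥ e₀ v = μ • e₁ v)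
    (h₀ : ∀ i v, f (m.succAbove i) *ᵥ e₀ v = ν i • e₀ (b i *ᵥ v))
    (h₁ : ∀ i v, f (m.succAbove i) *ᵥ e₁ v = ν i • e₁ (b i *ᵥ v)) (v : κ → ℂ) :
    ordProd f *ᵥ e₀ v = (μ * ∏ i, ν i) • e₁ (ordProd b *ᵥ v) := by
  have key : ∀ {n : ℕ} (f : Fin n → Matrix ι ι ℂ) (b : Fin n → Matrix κ κ ℂ) (ν : Fin n → ℂ)
      (_ : ∀ i v, f i *ᵥ e₀ v = ν i • e₀ (b i *ᵥ v)),
      ordProd f *ᵥ e₀ v = (∏ i, ν i) • e₀ (ordProd b *ᵥ v) := by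
    intro n
    induction n with
    | zero => intros; simp [ordProd]
    | succ n ih =>
      intro f b ν h
      rw [ordProd_succ, ordProd_succ, ← mulVec_mulVec, ih _ _ _ (fun i => h i.succ), mulVec_smul,
        h, smul_smul, mulVec_mulVec, Fin.prod_univ_succ, mul_comm]
  induction n with
  | zero =>
    obtain rfl : m = 0 := Fin.eq_zero m
    rw [ordProd_succ, ← mulVec_mulVec]
    simp [hm, ordProd]
  | succ n ih =>
    induction m using Fin.cases with
    | zero =>
      simp only [Fin.succAbove_zero] at h₀
      rw [ordProd_succ, ← mulVec_mulVec, key _ _ _ h₀, mulVec_smul, hm, smul_smul, mul_comm]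
    | succ m =>
      rw [ordProd_succ, ← mulVec_mulVec, ih m (fun i => f i.succ) (fun i => b i.succ)
        (fun i => ν i.succ) hm (fun i => by simpa using h₀ i.succ)
        (fun i => by simpa using h₁ i.succ), ordProd_succ b, mulVec_smul,
        ← mulVec_mulVec, Fin.prod_univ_succ]
      have := h₁ 0
      simp only [Fin.succ_succAbove_zero] at this
      rw [this, smul_smul]
      congr 1
      ring

/-- The block of an operator on `ℂ² ⊗ ℂ³` between fixed states of the second factor. -/
def siteBlock (M : Matrix (Fin 2 × Fin 3) (Fin 2 × Fin 3) ℂ) (s s' : Fin 3) :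
    Matrix (Fin 2) (Fin 2) ℂ :=
  Matrix.of fun ε ε' => M (ε, s) (ε', s')

lemma prod_R12at_apply (q c : ℂ) {N : ℕ} (z : Fin N → ℂ) (l : List (Fin N)) (hl : l.Nodup)
    (ε ε' : Fin 2) (σ τ : Fin N → Fin 3) :
    (l.map fun k => R12at q c (z k) k).prod (ε, σ) (ε', τ) =
      if ∀ k, k ∉ l → σ k = τ k then
        (l.map fun k => siteBlock (R12 q c (z k)) (σ k) (τ k)).prod ε ε' else 0 := by
  induction l generalizing ε σ with
  | nil =>
    simp only [List.map_nil, List.prod_nil, one_apply, Prod.mk.injEq, List.not_mem_nil,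
      not_false_eq_true, forall_const, ← funext_iff]
    by_cases h : σ = τ <;> simp [h]
  | cons a l ih =>
    obtain ⟨ha, hl⟩ := List.nodup_cons.1 hl
    rw [List.map_cons, List.prod_cons, List.map_cons, List.prod_cons, mul_apply,
      Fintype.sum_prod_type, mul_apply]
    have hsum : ∀ ε'' : Fin 2, (∑ ρ, R12at q c (z a) a (ε, σ) (ε'', ρ) *
        (l.map fun k => R12at q c (z k) k).prod (ε'', ρ) (ε', τ)) =
        if ∀ k, k ∉ a :: l → σ k = τ k then
          siteBlock (R12 q c (z a)) (σ a) (τ a) ε ε'' *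
            (l.map fun k => siteBlock (R12 q c (z k)) (σ k) (τ k)).prod ε'' ε' else 0 := by
      intro ε''
      rw [Finset.sum_eq_single (Function.update σ a (τ a))]
      · have hmap : (l.map fun k =>
            siteBlock (R12 q c (z k)) (Function.update σ a (τ a) k) (τ k)) =
            l.map fun k => siteBlock (R12 q c (z k)) (σ k) (τ k) := by
          refine List.map_congr_left fun k hk => ?_
          rw [Function.update_of_ne (by rintro rfl; exact ha hk)]
        have hcond : (∀ k, k ∉ l → Function.update σ a (τ a) k = τ k) ↔
            ∀ k, k ∉ a :: l → σ k = τ k := by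
          refine forall_congr' fun k => ?_
          by_cases hk : k = a
          · subst hk; simp
          · simp [hk]
        rw [ih hl, hmap]
        simp only [hcond, R12at, siteBlock, of_apply, Function.update_self]
        rw [if_pos (fun k hk => (Function.update_of_ne hk _ _).symm), mul_one, mul_ite, mul_zero]
      · intro ρ _ hρ
        rw [ih hl]
        by_cases h1 : ∀ k, k ≠ a → σ k = ρ k
        · rw [if_neg, mul_zero]
          intro h2
          refine hρ (funext fun k => ?_)
          by_cases hk : k = a
          · subst hk; simpa using h2 k ha
          · rw [Function.update_of_ne hk, h1 k hk]
        · simp [R12at, h1]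
      · simp
    simp only [hsum]
    split_ifs <;> simp

lemma Bop_apply (q c : ℂ) {N : ℕ} (w : Fin N → ℂ) (z : ℂ) (σ τ : Fin N → Fin 3) :
    Bop q c w z σ τ =
      revProd (fun k => siteBlock (R12 q c (q⁻¹ * z / w k)) (σ k) (τ k)) 0 1 := by
  rw [Bop, of_apply, monodromy,
    prod_R12at_apply _ _ _ _ (List.nodup_reverse.2 (List.nodup_finRange N))]
  simp [revProd]

lemma bethe_eq (q c : ℂ) {N : ℕ} (w : Fin N → ℂ) :
    bethe q c w = ordProd (fun j => Bop q c w (w j)) *ᵥ vac N := rfl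

/-- The exponent of `q` in the diagonal entries of `R12`. -/
def diagExp (ε : Fin 2) (s : Fin 3) : ℕ := if ε = 0 then 2 - s else s

lemma R12_apply (q c z : ℂ) (ε ε' : Fin 2) (s s' : Fin 3) :
    R12 q c z (ε, s) (ε', s') =
      if ε = ε' ∧ s = s' then br (q ^ diagExp ε s * z)
      else if (ε : ℕ) + s = ε' + s' then c else 0 := by
  fin_cases ε <;> fin_cases ε' <;> fin_cases s <;> fin_cases s' <;> simp [R12, diagExp]

lemma siteBlock_R12_conservation {q : ℂ} (hq : q ≠ 0) (c z : ℂ) (s s' : Fin 3) :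
    diagonal ![1, q] * siteBlock (R12 q c z) s s' =
      (q ^ (s' : ℕ) / q ^ (s : ℕ)) • (siteBlock (R12 q c z) s s' * diagonal ![1, q]) := by
  ext ε ε'
  have hpow : ∀ ε : Fin 2, (![1, q] : Fin 2 → ℂ) ε = q ^ (ε : ℕ) := by
    intro ε; fin_cases ε <;> simp
  rw [diagonal_mul, Matrix.smul_apply, mul_diagonal, hpow, hpow, siteBlock, of_apply, R12_apply,
    smul_eq_mul]
  have hs : q ^ (s : ℕ) ≠ 0 := pow_ne_zero _ hq
  split_ifs with h1 h2
  · obtain ⟨rfl, rfl⟩ := h1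
    rw [div_self hs]; ring
  · have : q ^ (ε : ℕ) * q ^ (s : ℕ) = q ^ (ε' : ℕ) * q ^ (s' : ℕ) := by
      rw [← pow_add, ← pow_add, h2]
    field_simp
    linear_combination c * this
  · simp

section Scaling

open Filter Bornology

lemma tendsto_inv_mul_br_mul (b : ℂ) :
    Tendsto (fun t : ℂ => t⁻¹ * br (b * t)) (cobounded ℂ) (nhds b) := by
  have h : Tendsto (fun t : ℂ => b - b⁻¹ * (t⁻¹ * t⁻¹)) (cobounded ℂ) (nhds (b - b⁻¹ * (0 * 0))) :=
    tendsto_const_nhds.sub (tendsto_const_nhds.mul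
      (tendsto_inv₀_cobounded.mul tendsto_inv₀_cobounded))
  rw [mul_zero, mul_zero, sub_zero] at h
  refine h.congr' ?_
  filter_upwards [eventually_ne_cobounded (0 : ℂ)] with t ht
  rw [br, mul_inv]
  field_simp

lemma tendsto_inv_mul_br_div (b : ℂ) :
    Tendsto (fun t : ℂ => t⁻¹ * br (b / t)) (cobounded ℂ) (nhds (-b⁻¹)) := by
  have h := (tendsto_inv_mul_br_mul b⁻¹).neg
  refine h.congr fun t => ?_
  simp only [br, div_eq_mul_inv, mul_inv, inv_inv]
  ring

lemma tendsto_inv_smul_siteBlock (q c b : ℂ) (s s' : Fin 3) :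
    Tendsto (fun t : ℂ => t⁻¹ • siteBlock (R12 q c (b * t)) s s') (cobounded ℂ)
      (nhds (diagonal fun ε => if s = s' then q ^ diagExp ε s * b else 0)) := by
  refine tendsto_pi_nhds.2 fun ε => tendsto_pi_nhds.2 fun ε' => ?_
  simp only [Matrix.smul_apply, siteBlock, of_apply, R12_apply, smul_eq_mul, diagonal_apply]
  by_cases h : ε = ε' ∧ s = s'
  · obtain ⟨rfl, rfl⟩ := h
    simpa [mul_assoc] using tendsto_inv_mul_br_mul (q ^ diagExp ε s * b)
  · have h0 : (if ε = ε' then (if s = s' then q ^ diagExp ε s * b else 0) else 0) = 0 := by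
      rw [← ite_and, if_neg h]
    simp only [if_neg h, h0]
    simpa using tendsto_inv₀_cobounded.mul_const (if (ε : ℕ) + s = ε' + s' then c else 0)

lemma tendsto_inv_smul_siteBlock_div (q c b : ℂ) (s s' : Fin 3) :
    Tendsto (fun t : ℂ => t⁻¹ • siteBlock (R12 q c (b / t)) s s') (cobounded ℂ)
      (nhds (diagonal fun ε => if s = s' then -(q ^ diagExp ε s * b)⁻¹ else 0)) := by
  refine tendsto_pi_nhds.2 fun ε => tendsto_pi_nhds.2 fun ε' => ?_
  simp only [Matrix.smul_apply, siteBlock, of_apply, R12_apply, smul_eq_mul, diagonal_apply]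
  by_cases h : ε = ε' ∧ s = s'
  · obtain ⟨rfl, rfl⟩ := h
    simpa only [mul_div_assoc, and_self, if_true] using
      tendsto_inv_mul_br_div (q ^ diagExp ε s * b)
  · have h0 : (if ε = ε' then (if s = s' then -(q ^ diagExp ε s * b)⁻¹ else 0) else 0) = 0 := by
      rw [← ite_and, if_neg h]
    simp only [if_neg h, h0]
    simpa using tendsto_inv₀_cobounded.mul_const (if (ε : ℕ) + s = ε' + s' then c else 0)

end Scaling

section LimitOperators

variable {n : ℕ} (q c : ℂ) (j : Fin (n + 1)) (u : Fin n → ℂ)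

/-- The limit of `t⁻¹ • ℬ(u i)` as the inhomogeneity `t` at site `j` tends to infinity. -/
def limBopOff (i : Fin n) : Matrix (Fin (n + 1) → Fin 3) (Fin (n + 1) → Fin 3) ℂ :=
  Matrix.of fun σ τ => revProd (j.insertNth (α := fun _ => Matrix (Fin 2) (Fin 2) ℂ)
    (diagonal fun ε => if σ j = τ j then -(q ^ diagExp ε (σ j) * (q⁻¹ * u i))⁻¹ else 0)
    (fun l => siteBlock (R12 q c (q⁻¹ * u i / u l))
      (σ (j.succAbove l)) (τ (j.succAbove l)))) 0 1

/-- The limit of `t⁻ⁿ • ℬ(t)` as the inhomogeneity `t` at site `j` tends to infinity. -/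
def limBopAt : Matrix (Fin (n + 1) → Fin 3) (Fin (n + 1) → Fin 3) ℂ :=
  Matrix.of fun σ τ => revProd (j.insertNth (α := fun _ => Matrix (Fin 2) (Fin 2) ℂ)
    (siteBlock (R12 q c q⁻¹) (σ j) (τ j))
    (fun l => diagonal fun ε => if σ (j.succAbove l) = τ (j.succAbove l) then
      q ^ diagExp ε (σ (j.succAbove l)) * (q⁻¹ / u l) else 0)) 0 1

lemma tendsto_limBopOff (i : Fin n) :
    Filter.Tendsto (fun t : ℂ => t⁻¹ • Bop q c (j.insertNth t u) (u i))
      (Bornology.cobounded ℂ) (nhds (limBopOff q c j u i)) := by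
  refine tendsto_pi_nhds.2 fun σ => tendsto_pi_nhds.2 fun τ => ?_
  have hsmul : ∀ t : ℂ, (t⁻¹ • Bop q c (j.insertNth t u) (u i)) σ τ =
      revProd (fun k => (j.insertNth (α := fun _ => ℂ) t⁻¹ (fun _ => 1) k) •
        siteBlock (R12 q c (q⁻¹ * u i / (j.insertNth (α := fun _ => ℂ) t u) k))
          (σ k) (τ k)) 0 1 := by
    intro t
    rw [revProd_smul, Fin.prod_univ_succAbove _ j, Matrix.smul_apply, Matrix.smul_apply, Bop_apply]
    simp
  simp only [hsmul]
  have hentry : Continuous fun A : Matrix (Fin 2) (Fin 2) ℂ => A 0 1 := by fun_prop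
  refine (hentry.tendsto _).comp (tendsto_revProd fun k => ?_)
  obtain rfl | ⟨l, rfl⟩ := Fin.eq_self_or_eq_succAbove j k
  · simpa only [Fin.insertNth_apply_same] using tendsto_inv_smul_siteBlock_div q c _ _ _
  · simp only [Fin.insertNth_apply_succAbove, one_smul]
    exact tendsto_const_nhds

lemma tendsto_limBopAt :
    Filter.Tendsto (fun t : ℂ => (t ^ n)⁻¹ • Bop q c (j.insertNth t u) t)
      (Bornology.cobounded ℂ) (nhds (limBopAt q c j u)) := by
  refine tendsto_pi_nhds.2 fun σ => tendsto_pi_nhds.2 fun τ => ?_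
  have hsmul : ∀ t : ℂ, ((t ^ n)⁻¹ • Bop q c (j.insertNth t u) t) σ τ =
      revProd (fun k => (j.insertNth (α := fun _ => ℂ) 1 (fun _ => t⁻¹) k) •
        siteBlock (R12 q c (q⁻¹ * t / (j.insertNth (α := fun _ => ℂ) t u) k))
          (σ k) (τ k)) 0 1 := by
    intro t
    rw [revProd_smul, Fin.prod_univ_succAbove _ j, Matrix.smul_apply, Matrix.smul_apply, Bop_apply]
    simp
  simp only [hsmul]
  have hentry : Continuous fun A : Matrix (Fin 2) (Fin 2) ℂ => A 0 1 := by fun_prop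
  refine (hentry.tendsto _).comp (tendsto_revProd fun k => ?_)
  obtain rfl | ⟨l, rfl⟩ := Fin.eq_self_or_eq_succAbove j k
  · simp only [Fin.insertNth_apply_same, one_smul]
    refine tendsto_const_nhds.congr' ?_
    filter_upwards [Bornology.eventually_ne_cobounded (0 : ℂ)] with t ht
    rw [mul_div_assoc, div_self ht, mul_one]
  · simp only [Fin.insertNth_apply_succAbove]
    refine (tendsto_inv_smul_siteBlock q c _ _ _).congr fun t => ?_
    rw [div_mul_eq_mul_div]

/-- The embedding of the states on `n` sites obtained by inserting the letter `s` at site `j`. -/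
def insertState (s : Fin 3) (v : (Fin n → Fin 3) → ℂ) : (Fin (n + 1) → Fin 3) → ℂ :=
  fun σ => if σ j = s then v (fun i => σ (j.succAbove i)) else 0

lemma mulVec_insertState (A : Matrix (Fin (n + 1) → Fin 3) (Fin (n + 1) → Fin 3) ℂ) (s : Fin 3)
    (v : (Fin n → Fin 3) → ℂ) (σ : Fin (n + 1) → Fin 3) :
    (A *ᵥ insertState j s v) σ =
      ∑ τ : Fin n → Fin 3, A σ (j.insertNth (α := fun _ => Fin 3) s τ) * v τ := by
  rw [mulVec, dotProduct, ← (Fin.insertNthEquiv (fun _ => Fin 3) j).sum_comp,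
    Fintype.sum_prod_type, Finset.sum_eq_single s]
  · simp [insertState]
    rfl
  · intro s' _ hs'
    simp [insertState, hs']
  · simp

/-- The diagonal gauge factor counting `q` for letters before and `q⁻¹` for letters after `j`. -/
def letterGauge (τ : Fin n → Fin 3) : ℂ :=
  ∏ i, if i.castSucc < j then q ^ (τ i : ℕ) else (q ^ (τ i : ℕ))⁻¹

variable {q u}

lemma letterGauge_ne_zero (hq : q ≠ 0) (τ : Fin n → Fin 3) : letterGauge q j τ ≠ 0 := by
  refine Finset.prod_ne_zero_iff.2 fun i _ => ?_
  split_ifs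
  · exact pow_ne_zero _ hq
  · exact inv_ne_zero (pow_ne_zero _ hq)

lemma limBopOff_apply_of_ne (i : Fin n) (σ : Fin (n + 1) → Fin 3) (s : Fin 3) (τ : Fin n → Fin 3)
    (h : σ j ≠ s) : limBopOff q c j u i σ (j.insertNth (α := fun _ => Fin 3) s τ) = 0 := by
  rw [limBopOff, of_apply, revProd_eq_of_commute j _ 1 1 0 (fun _ => 1) (fun _ => 1)]
  · simp
  · simp [h]
  · simp
  · simp

lemma limBopOff_apply_one (hq : q ≠ 0) (i : Fin n) (σ : Fin (n + 1) → Fin 3) (τ : Fin n → Fin 3)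
    (h : σ j = 1) : limBopOff q c j u i σ (j.insertNth (α := fun _ => Fin 3) 1 τ) =
      -(u i)⁻¹ * Bop q c u (u i) (fun l => σ (j.succAbove l)) τ := by
  rw [limBopOff, of_apply,
    revProd_eq_of_commute j _ 1 1 (-(u i)⁻¹) (fun _ => 1) (fun _ => 1), Bop_apply]
  · simp
  · ext ε ε'
    fin_cases ε <;> fin_cases ε' <;> simp [h, diagExp, hq]
  · simp
  · simp

lemma limBopOff_apply_zero (hq : q ≠ 0) (i : Fin n) (σ : Fin (n + 1) → Fin 3) (τ : Fin n → Fin 3)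
    (h : σ j = 0) : limBopOff q c j u i σ (j.insertNth (α := fun _ => Fin 3) 0 τ) =
      -(u i)⁻¹ * (letterGauge q j τ / letterGauge q j (fun l => σ (j.succAbove l))) *
        Bop q c u (u i) (fun l => σ (j.succAbove l)) τ := by
  have hcomm : ∀ l, _ := fun l : Fin n => siteBlock_R12_conservation hq c (q⁻¹ * u i / u l)
    (σ (j.succAbove l)) (τ l)
  rw [limBopOff, of_apply, revProd_eq_of_commute j _ (diagonal ![1, q]) (diagonal ![1, q])
    (-(q * u i)⁻¹) (fun l => q ^ (τ l : ℕ) / q ^ (σ (j.succAbove l) : ℕ))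
    (fun l => (q ^ (τ l : ℕ) / q ^ (σ (j.succAbove l) : ℕ))⁻¹), Bop_apply]
  · have hg : (∏ l : Fin n, if l.castSucc < j then q ^ (τ l : ℕ) / q ^ (σ (j.succAbove l) : ℕ)
        else (q ^ (τ l : ℕ) / q ^ (σ (j.succAbove l) : ℕ))⁻¹) =
        letterGauge q j τ / letterGauge q j (fun l => σ (j.succAbove l)) := by
      rw [letterGauge, letterGauge, ← Finset.prod_div_distrib]
      refine Finset.prod_congr rfl fun l _ => ?_
      split_ifs
      · rfl
      · rw [inv_div_inv, inv_div]
    rw [hg, Matrix.smul_apply, mul_diagonal, diagonal_mul]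
    simp only [Fin.insertNth_apply_succAbove, cons_val_zero, cons_val_one, smul_eq_mul, one_mul,
      mul_inv]
    field_simp
  · ext ε ε'
    fin_cases ε <;> fin_cases ε' <;> simp [h, diagExp]
    · field_simp
    · field_simp
  · intro l
    simpa using hcomm l
  · intro l
    simp only [Fin.insertNth_apply_succAbove]
    rw [hcomm l, smul_smul, inv_mul_cancel₀ (div_ne_zero (pow_ne_zero _ hq) (pow_ne_zero _ hq)),
      one_smul]

lemma limBopOff_mulVec_one (hq : q ≠ 0) (i : Fin n) (v : (Fin n → Fin 3) → ℂ) :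
    limBopOff q c j u i *ᵥ insertState j 1 v =
      (-(u i)⁻¹) • insertState j 1 (Bop q c u (u i) *ᵥ v) := by
  ext σ
  rw [mulVec_insertState, Pi.smul_apply, insertState, smul_eq_mul]
  split_ifs with h
  · simp only [limBopOff_apply_one c j hq i σ _ h, mulVec, dotProduct, Finset.mul_sum, mul_assoc]
  · simp [limBopOff_apply_of_ne c j i σ 1 _ h]

lemma limBopOff_mulVec_zero (hq : q ≠ 0) (i : Fin n) (v : (Fin n → Fin 3) → ℂ) :
    limBopOff q c j u i *ᵥ insertState j 0 (fun τ => (letterGauge q j τ)⁻¹ * v τ) =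
      (-(u i)⁻¹) •
        insertState j 0 (fun τ => (letterGauge q j τ)⁻¹ * (Bop q c u (u i) *ᵥ v) τ) := by
  ext σ
  rw [mulVec_insertState, Pi.smul_apply, insertState, smul_eq_mul]
  split_ifs with h
  · simp only [limBopOff_apply_zero c j hq i σ _ h, mulVec, dotProduct, Finset.mul_sum]
    refine Finset.sum_congr rfl fun τ _ => ?_
    have := letterGauge_ne_zero j hq τ
    field_simp
  · simp [limBopOff_apply_of_ne c j i σ 0 _ h]

lemma limBopAt_mulVec_zero (hq : q ≠ 0) (v : (Fin n → Fin 3) → ℂ) :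
    limBopAt q c j u *ᵥ insertState j 0 (fun τ => (letterGauge q j τ)⁻¹ * v τ) =
      (c * ∏ i : Fin n, if i.castSucc < j then (q * u i)⁻¹ else q / u i) •
        insertState j 1 v := by
  ext σ
  rw [mulVec_insertState, Finset.sum_eq_single (fun i => σ (j.succAbove i)), limBopAt, of_apply,
    revProd_apply_of_diagonal j _ (fun l ε => q ^ diagExp ε (σ (j.succAbove l)) * (q⁻¹ / u l)),
    Fin.insertNth_apply_same, Fin.insertNth_apply_same, Pi.smul_apply, insertState, smul_eq_mul]
  · have hM : siteBlock (R12 q c q⁻¹) (σ j) 0 0 1 = if σ j = 1 then c else 0 := by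
      generalize σ j = s
      fin_cases s <;> simp [siteBlock, R12]
    have hprod : (∏ l : Fin n, if l.castSucc < j then
          q ^ diagExp 1 (σ (j.succAbove l)) * (q⁻¹ / u l)
        else q ^ diagExp 0 (σ (j.succAbove l)) * (q⁻¹ / u l)) =
        letterGauge q j (fun l => σ (j.succAbove l)) *
          ∏ i : Fin n, if i.castSucc < j then (q * u i)⁻¹ else q / u i := by
      rw [letterGauge, ← Finset.prod_mul_distrib]
      refine Finset.prod_congr rfl fun l _ => ?_
      generalize σ (j.succAbove l) = s
      split_ifs
      · rw [show diagExp 1 s = s by simp [diagExp], mul_inv, div_eq_mul_inv]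
      · fin_cases s <;> simp [diagExp] <;> field_simp
    rw [hM, hprod]
    have := letterGauge_ne_zero j hq (fun l => σ (j.succAbove l))
    split_ifs
    · field_simp
    · simp
  · intro l
    simp
  · intro τ _ hτ
    obtain ⟨l, hl⟩ := Function.ne_iff.1 hτ
    rw [limBopAt, of_apply, revProd_apply_of_diagonal j _ (fun l ε => if σ (j.succAbove l) = τ l then
      q ^ diagExp ε (σ (j.succAbove l)) * (q⁻¹ / u l) else 0), Finset.prod_eq_zero (mem_univ l)]
    · simp
    · simp [hl.symm]
    · simp
  · simp

lemma insertState_vac :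
    insertState j 0 (fun τ => (letterGauge q j τ)⁻¹ * vac n τ) = vac (n + 1) := by
  ext σ
  have hσ : σ = (fun _ => 0) ↔ σ j = 0 ∧ (fun i => σ (j.succAbove i)) = fun _ => 0 := by
    simp [funext_iff, Fin.forall_iff_succAbove j]
  simp only [insertState, vac, hσ, ite_and]
  split_ifs with h1 h2
  · simp [letterGauge, congrFun h2]
  · simp
  · rfl

lemma tendsto_bethe (hq : q ≠ 0) (σ : Fin (n + 1) → Fin 3) :
    Filter.Tendsto (fun t : ℂ => (t ^ n)⁻¹ * (t ^ n)⁻¹ * bethe q c (j.insertNth t u) σ)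
      (Bornology.cobounded ℂ)
      (nhds (c * (∏ i : Fin n, if i.castSucc < j then (q * u i)⁻¹ else q / u i) *
        (∏ i, -(u i)⁻¹) *
        if σ j = 1 then bethe q c u (fun i => σ (j.succAbove i)) else 0)) := by
  have hlim := congrFun (ordProd_mulVec_of_intertwine j
    (j.insertNth (α := fun _ => Matrix (Fin (n + 1) → Fin 3) (Fin (n + 1) → Fin 3) ℂ)
      (limBopAt q c j u) (limBopOff q c j u)) (fun i => Bop q c u (u i))
    (fun v => insertState j 0 (fun τ => (letterGauge q j τ)⁻¹ * v τ)) (insertState j 1) _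
    (fun i => -(u i)⁻¹)
    (fun v => by simpa only [Fin.insertNth_apply_same] using limBopAt_mulVec_zero c j hq v)
    (fun i v => by
      simpa only [Fin.insertNth_apply_succAbove] using limBopOff_mulVec_zero c j hq i v)
    (fun i v => by
      simpa only [Fin.insertNth_apply_succAbove] using limBopOff_mulVec_one c j hq i v) (vac n)) σ
  rw [insertState_vac, Pi.smul_apply, insertState, smul_eq_mul, ← bethe_eq] at hlim
  rw [← hlim]
  have hop : Filter.Tendsto (fun t : ℂ => ordProd fun k =>
      (j.insertNth (α := fun _ => ℂ) (t ^ n)⁻¹ (fun _ => t⁻¹) k) •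
        Bop q c (j.insertNth t u) ((j.insertNth (α := fun _ => ℂ) t u) k))
      (Bornology.cobounded ℂ) (nhds (ordProd
        (j.insertNth (α := fun _ => Matrix (Fin (n + 1) → Fin 3) (Fin (n + 1) → Fin 3) ℂ)
          (limBopAt q c j u) (limBopOff q c j u)))) := by
    refine tendsto_ordProd fun k => ?_
    obtain rfl | ⟨i, rfl⟩ := Fin.eq_self_or_eq_succAbove j k
    · simpa only [Fin.insertNth_apply_same] using tendsto_limBopAt q c k u
    · simpa only [Fin.insertNth_apply_succAbove] using tendsto_limBopOff q c j u i
  have hvec : Continuous fun A : Matrix (Fin (n + 1) → Fin 3) (Fin (n + 1) → Fin 3) ℂ =>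
      (A *ᵥ vac (n + 1)) σ :=
    (continuous_apply σ).comp (Continuous.matrix_mulVec continuous_id continuous_const)
  refine ((hvec.tendsto _).comp hop).congr fun t => ?_
  rw [Function.comp_apply, ordProd_smul, Fin.prod_univ_succAbove _ j, smul_mulVec, Pi.smul_apply,
    bethe_eq]
  simp

end LimitOperators

lemma prod_pairs_succAbove {n : ℕ} (j : Fin (n + 1)) (g : Fin (n + 1) → Fin (n + 1) → ℂ) :
    (∏ pr ∈ Finset.univ.filter (fun pr : Fin (n + 1) × Fin (n + 1) => pr.1 < pr.2),
      g pr.1 pr.2) =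
    (∏ pr ∈ Finset.univ.filter (fun pr : Fin n × Fin n => pr.1 < pr.2),
      g (j.succAbove pr.1) (j.succAbove pr.2)) *
    ∏ i : Fin n, if i.castSucc < j then g (j.succAbove i) j else g j (j.succAbove i) := by
  rw [Finset.prod_filter, Finset.prod_filter, Fintype.prod_prod_type, Fintype.prod_prod_type,
    Fin.prod_univ_succAbove _ j]
  simp_rw [Fin.prod_univ_succAbove _ j]
  simp only [lt_self_iff_false, if_false,
    one_mul, Fin.succAbove_lt_succAbove_iff, Finset.prod_mul_distrib,
    Fin.succAbove_lt_iff_castSucc_lt, Fin.lt_succAbove_iff_le_castSucc]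
  rw [← mul_assoc, ← Finset.prod_mul_distrib, mul_comm]
  congr 1
  refine Finset.prod_congr rfl fun i _ => ?_
  by_cases h : i.castSucc < j
  · simp [h, not_le.2 h]
  · simp [h, not_lt.1 h]

lemma prod_br_pairs (q : ℂ) {n : ℕ} (j : Fin (n + 1)) (u : Fin n → ℂ) (t : ℂ) :
    (∏ pr ∈ Finset.univ.filter (fun pr : Fin (n + 1) × Fin (n + 1) => pr.1 < pr.2),
      br (q * (j.insertNth (α := fun _ => ℂ) t u) pr.1 /
        (j.insertNth (α := fun _ => ℂ) t u) pr.2)) =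
    (∏ pr ∈ Finset.univ.filter (fun pr : Fin n × Fin n => pr.1 < pr.2),
      br (q * u pr.1 / u pr.2)) *
    ∏ i : Fin n, if i.castSucc < j then br (q * u i / t) else br (q / u i * t) := by
  rw [prod_pairs_succAbove j (fun k l => br (q * (j.insertNth (α := fun _ => ℂ) t u) k /
    (j.insertNth (α := fun _ => ℂ) t u) l))]
  simp only [Fin.insertNth_apply_same, Fin.insertNth_apply_succAbove, div_mul_eq_mul_div]

lemma tendsto_prod_br {q : ℂ} {n : ℕ} (j : Fin (n + 1)) (u : Fin n → ℂ) :
    Filter.Tendsto (fun t : ℂ => (t ^ n)⁻¹ *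
        ∏ i : Fin n, if i.castSucc < j then br (q * u i / t) else br (q / u i * t))
      (Bornology.cobounded ℂ)
      (nhds (∏ i : Fin n, if i.castSucc < j then -(q * u i)⁻¹ else q / u i)) := by
  have h : ∀ t : ℂ, (t ^ n)⁻¹ *
      (∏ i : Fin n, if i.castSucc < j then br (q * u i / t) else br (q / u i * t)) =
      ∏ i : Fin n, t⁻¹ * if i.castSucc < j then br (q * u i / t) else br (q / u i * t) := by
    intro t
    rw [Finset.prod_mul_distrib]
    simp
  simp only [h]
  refine tendsto_finsetProd _ fun i _ => ?_
  split_ifs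
  · exact tendsto_inv_mul_br_div _
  · exact tendsto_inv_mul_br_mul _

lemma prod_sign {n : ℕ} (j : Fin (n + 1)) :
    (∏ i : Fin n, if i.castSucc < j then (1 : ℂ) else -1) = (-1) ^ (n - (j : ℕ)) := by
  induction n with
  | zero => simp
  | succ n ih =>
    induction j using Fin.cases with
    | zero => simp
    | succ j => rw [Fin.prod_univ_succ]; simpa using ih j

lemma tendsto_betheTilde_cobounded {q c : ℂ} (hq : q ≠ 0) (hc : c ≠ 0) {n : ℕ} (j : Fin (n + 1))
    (u : Fin n → ℂ) (hu : ∀ k, u k ≠ 0) (σ : Fin (n + 1) → Fin 3) :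
    Filter.Tendsto (fun t : ℂ => (t ^ n)⁻¹ * betheTilde q c (j.insertNth t u) σ)
      (Bornology.cobounded ℂ)
      (nhds ((-1 : ℂ) ^ (n - (j : ℕ)) * (if σ j = 1 then 1 else 0) *
        (∏ k, (u k)⁻¹) * betheTilde q c u (fun i => σ (j.succAbove i)))) := by
  have hν : (∏ i : Fin n, if i.castSucc < j then -(q * u i)⁻¹ else q / u i) ≠ 0 := by
    refine Finset.prod_ne_zero_iff.2 fun i _ => ?_
    split_ifs
    · exact neg_ne_zero.2 (inv_ne_zero (mul_ne_zero hq (hu i)))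
    · exact div_ne_zero hq (hu i)
  have hratio : (∏ i : Fin n, if i.castSucc < j then (q * u i)⁻¹ else q / u i) *
      (∏ i, -(u i)⁻¹) = (-1) ^ (n - (j : ℕ)) * (∏ k, (u k)⁻¹) *
        ∏ i : Fin n, if i.castSucc < j then -(q * u i)⁻¹ else q / u i := by
    rw [← prod_sign, ← Finset.prod_mul_distrib, ← Finset.prod_mul_distrib,
      ← Finset.prod_mul_distrib]
    refine Finset.prod_congr rfl fun i _ => ?_
    split_ifs <;> ring
  have h := (((tendsto_prod_br (q := q) j u).inv₀ hν).mul
    (tendsto_bethe (u := u) c j hq σ)).const_mul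
    ((c ^ (n + 1))⁻¹ * (∏ pr ∈ Finset.univ.filter (fun pr : Fin n × Fin n => pr.1 < pr.2),
      br (q * u pr.1 / u pr.2))⁻¹)
  rw [mul_assoc c, hratio] at h
  generalize (∏ i : Fin n, if i.castSucc < j then -(q * u i)⁻¹ else q / u i) = ν at h hν
  convert h.congr' ?_ using 2
  · rw [betheTilde, Pi.smul_apply, smul_eq_mul]
    split_ifs
    · field_simp
      ring
    · simp
  · filter_upwards [Bornology.eventually_ne_cobounded (0 : ℂ)] with t ht
    rw [betheTilde, Pi.smul_apply, smul_eq_mul, prod_br_pairs]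
    simp only [mul_inv, inv_inv]
    field_simp

section Inversion

lemma br_inv (z : ℂ) : br z⁻¹ = -br z := by
  simp [br]

lemma R12_inv (q c z : ℂ) : R12 q⁻¹ (-c) z⁻¹ = -R12 q c z := by
  ext ⟨ε, s⟩ ⟨ε', s'⟩
  rw [Matrix.neg_apply, R12_apply, R12_apply, inv_pow, ← mul_inv, br_inv]
  split_ifs <;> simp

lemma Bop_inv (q c : ℂ) {N : ℕ} (w : Fin N → ℂ) (z : ℂ) :
    Bop q⁻¹ (-c) (fun k => (w k)⁻¹) z⁻¹ = (-1 : ℂ) ^ N • Bop q c w z := by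
  ext σ τ
  have h : ∀ k, siteBlock (R12 q⁻¹ (-c) (q⁻¹⁻¹ * z⁻¹ / (w k)⁻¹)) (σ k) (τ k) =
      (-1 : ℂ) • siteBlock (R12 q c (q⁻¹ * z / w k)) (σ k) (τ k) := by
    intro k
    rw [← mul_inv, inv_div_inv, ← inv_div, R12_inv]
    ext
    simp [siteBlock]
  rw [Matrix.smul_apply, Bop_apply, Bop_apply]
  simp only [h]
  rw [revProd_smul]
  simp

lemma bethe_inv (q c : ℂ) {N : ℕ} (w : Fin N → ℂ) :
    bethe q⁻¹ (-c) (fun k => (w k)⁻¹) = (-1 : ℂ) ^ N • bethe q c w := by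
  rw [bethe_eq, bethe_eq]
  simp only [Bop_inv]
  rw [ordProd_smul, smul_mulVec]
  congr 1
  rcases Nat.even_or_odd N with h | h <;> simp [h.neg_one_pow]

lemma betheTilde_inv (q c : ℂ) {N : ℕ} (w : Fin N → ℂ) :
    betheTilde q⁻¹ (-c) (fun k => (w k)⁻¹) =
      (∏ pr ∈ Finset.univ.filter (fun pr : Fin N × Fin N => pr.1 < pr.2), (-1 : ℂ)) •
        betheTilde q c w := by
  have h : ∀ pr : Fin N × Fin N, br (q⁻¹ * (w pr.1)⁻¹ / (w pr.2)⁻¹) =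
      -1 * br (q * w pr.1 / w pr.2) := by
    intro pr
    rw [← mul_inv, inv_div_inv, ← inv_div, br_inv, neg_one_mul]
  rw [betheTilde, betheTilde, bethe_inv, smul_smul, smul_smul]
  simp only [h]
  rw [Finset.prod_mul_distrib, neg_pow c, Finset.prod_const]
  generalize #(Finset.univ.filter fun pr : Fin N × Fin N => pr.1 < pr.2) = m
  simp only [mul_inv, ← inv_pow, inv_neg, inv_one]
  congr 1
  have hs : ((-1 : ℂ) ^ N) * (-1) ^ N = 1 := by rw [← mul_pow]; simp
  linear_combination (c⁻¹ ^ N * (-1) ^ m * (∏ pr ∈ Finset.univ.filter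
    (fun pr : Fin N × Fin N => pr.1 < pr.2), br (q * w pr.1 / w pr.2))⁻¹) * hs

end Inversion

/-- Asymptotics of the renormalised Bethe vector as the inhomogeneity at position `j`
tends to ∞ resp. 0: it reduces to the (N−1)-site vector with the j-th site frozen to `0`. -/
theorem stmt15 (q c : ℂ) (hq : q ≠ 0) (hq4 : q^4 ≠ 1) (hc : c^2 = br q * br (q^2))
    (n : ℕ) (hn : 1 ≤ n) (j : Fin (n+1)) (u : Fin n → ℂ) (hu : ∀ k, u k ≠ 0)
    (hgen : ∀ k l : Fin n, k ≠ l → q * u k / u l ≠ 1 ∧ q * u k / u l ≠ -1)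
    (σ : Fin (n+1) → Fin 3) :
    Filter.Tendsto (fun t : ℂ => (t ^ n)⁻¹ * betheTilde q c (j.insertNth t u) σ)
      (Bornology.cobounded ℂ)
      (nhds ((-1 : ℂ)^(n - (j : ℕ)) * (if σ j = 1 then 1 else 0) *
        (∏ k, (u k)⁻¹) * betheTilde q c u (fun i => σ (j.succAbove i)))) ∧
    Filter.Tendsto (fun t : ℂ => t ^ n * betheTilde q c (j.insertNth t u) σ)
      (nhdsWithin 0 {0}ᶜ)
      (nhds ((-1 : ℂ)^(j : ℕ) * (if σ j = 1 then 1 else 0) *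
        (∏ k, u k) * betheTilde q c u (fun i => σ (j.succAbove i)))) := by
  have hc0 : c ≠ 0 := by
    rintro rfl
    have hbr : ∀ z : ℂ, br z = 0 → z ≠ 0 → z ^ 2 = 1 := by
      intro z h hz
      rw [br] at h
      field_simp at h
      linear_combination h
    rw [zero_pow two_ne_zero] at hc
    rcases mul_eq_zero.1 hc.symm with h | h
    · exact hq4 (by linear_combination (q ^ 2 + 1) * hbr q h hq)
    · exact hq4 (by linear_combination hbr (q ^ 2) h (pow_ne_zero _ hq))
  refine ⟨tendsto_betheTilde_cobounded hq hc0 j u hu σ, ?_⟩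
  have h := (tendsto_betheTilde_cobounded (inv_ne_zero hq) (neg_ne_zero.2 hc0) j
    (fun k => (u k)⁻¹) (fun k => inv_ne_zero (hu k)) σ).comp
      (Filter.tendsto_inv₀_nhdsNE_zero (α := ℂ))
  have hins : ∀ t : ℂ, (j.insertNth (α := fun _ => ℂ) t⁻¹ fun k => (u k)⁻¹) =
      fun k => (j.insertNth (α := fun _ => ℂ) t u k)⁻¹ := by
    intro t
    ext k
    obtain rfl | ⟨i, rfl⟩ := Fin.eq_self_or_eq_succAbove j k <;> simp
  simp only [Function.comp_def, hins, betheTilde_inv, Pi.smul_apply, smul_eq_mul, inv_pow,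
    inv_inv] at h
  rw [prod_pairs_succAbove j (fun _ _ => (-1 : ℂ))] at h
  have hs : (∏ pr ∈ Finset.univ.filter (fun pr : Fin n × Fin n => pr.1 < pr.2), (-1 : ℂ)) *
      (∏ pr ∈ Finset.univ.filter (fun pr : Fin n × Fin n => pr.1 < pr.2), (-1 : ℂ)) = 1 := by
    simp [← mul_pow]
  generalize (∏ pr ∈ Finset.univ.filter (fun pr : Fin n × Fin n => pr.1 < pr.2), (-1 : ℂ)) = s
    at h hs
  simp only [ite_self, Finset.prod_const, Finset.card_univ, Fintype.card_fin] at h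
  have hn2 : ((-1 : ℂ) ^ n) * (-1) ^ n = 1 := by simp [← mul_pow]
  have hj : (-1 : ℂ) ^ n * (-1) ^ (n - (j : ℕ)) = (-1) ^ (j : ℕ) := by
    have hle : (j : ℕ) ≤ n := Fin.is_le j
    rw [← pow_add, show n + (n - (j : ℕ)) = 2 * (n - j) + j by omega, pow_add, pow_mul]
    simp
  convert h.const_mul (s * (-1) ^ n) using 2 with t
  · linear_combination (-t ^ n * betheTilde q c (j.insertNth t u) σ) *
      ((-1) ^ n * (-1) ^ n * hs + hn2)
  · rw [← hj]
    linear_combination (-((-1) ^ n * (-1) ^ (n - (j : ℕ)) * (if σ j = 1 then 1 else 0) *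
      (∏ k, u k) * betheTilde q c u (fun i => σ (j.succAbove i)))) * hs

end
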